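/- arXiv:2305.10522 — 14 statements merged into one kernel-verified Lean document; each statement's English description precedes it below -/
import Mathlib

section
/- Under the state relations, the quadratic coefficients satisfy b = p₊ + p₋ and c = −p₊p₋ ≥ 0; moreover p₊ = p > 0 and p₋ ≤ 0. Consequently the discriminant satisfies d = b² + 4c = (p₊ − p₋)² > 0, and p₊ = (b + √d)/2 and p₋ = (b − √d)/2, i.e., p₊ is the larger and p₋ the smaller root of the quadratic equation X² − bX − c = 0. -/
/-- Under the stiffened-gas binary mixture state relations, the quadratic
coefficients satisfy `b = p₊ + p₋`, `c = −p₊p₋ ≥ 0`, `p₊ = p > 0`, `p₋ ≤ 0`; consequently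
`d = b² + 4c = (p₊ − p₋)² > 0` and `p₊ = (b + √d)/2`, `p₋ = (b − √d)/2`. -/
theorem stmt0
    (R1 R2 cV1 cV2 pst1 pst2 e01 e02 α1 α2 r1 r2 θ p : ℝ)
    (hR1 : 0 < R1) (hR2 : 0 < R2) (hcV1 : 0 < cV1) (hcV2 : 0 < cV2)
    (hpst1 : 0 ≤ pst1) (hpst2 : 0 ≤ pst2)
    (hα1 : 0 < α1) (hα1' : α1 < 1) (hα2 : 0 < α2) (hα2' : α2 < 1)
    (hαsum : α1 + α2 = 1)
    (hr1 : 0 < r1) (hr2 : 0 < r2) (hθ : 0 < θ) (hp : 0 < p)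
    (hp1 : p = R1 * r1 * θ - pst1) (hp2 : p = R2 * r2 * θ - pst2)
    (ρ1 ρ2 ρ cV R γ ε0 σ1 σ2 ε : ℝ)
    (hρ1 : ρ1 = α1 * r1) (hρ2 : ρ2 = α2 * r2) (hρ : ρ = ρ1 + ρ2)
    (hcV : cV = (cV1 * ρ1 + cV2 * ρ2) / ρ) (hR : R = (R1 * ρ1 + R2 * ρ2) / ρ)
    (hγ : γ = R / cV + 1)
    (hε0 : ε0 = (ρ1 * e01 + ρ2 * e02) / ρ)
    (hσ1 : σ1 = R1 * ρ1 / (cV * ρ)) (hσ2 : σ2 = R2 * ρ2 / (cV * ρ))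
    (hε : ρ * (ε - ε0) = cV * ρ * θ + α1 * pst1 + α2 * pst2)
    (b c d pp pm : ℝ)
    (hb : b = σ1 * (ρ * (ε - ε0) - pst1) + σ2 * (ρ * (ε - ε0) - pst2) - pst1 - pst2)
    (hc : c = σ1 * (ρ * (ε - ε0) - pst1) * pst2 + σ2 * (ρ * (ε - ε0) - pst2) * pst1
        - pst1 * pst2)
    (hd : d = b ^ 2 + 4 * c)
    (hpp : pp = R * ρ * θ - (α1 * pst1 + α2 * pst2))
    (hpm : pm = -(α1 * pst2 + α2 * pst1 + α1 * α2 * (pst2 - pst1) ^ 2 / (cV * ρ * θ))) :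
    b = pp + pm ∧ c = -(pp * pm) ∧ 0 ≤ c ∧ pp = p ∧ 0 < pp ∧ pm ≤ 0 ∧
      d = (pp - pm) ^ 2 ∧ 0 < d ∧
      pp = (b + Real.sqrt d) / 2 ∧ pm = (b - Real.sqrt d) / 2 := by
  have hρ1_pos : 0 < ρ1 := hρ1 ▸ mul_pos hα1 hr1
  have hρ2_pos : 0 < ρ2 := hρ2 ▸ mul_pos hα2 hr2
  have hρ_pos : 0 < ρ := hρ ▸ add_pos hρ1_pos hρ2_pos
  have hcV_pos : 0 < cV := by rw [hcV]; positivity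
  have hK : 0 < cV * ρ * θ := by positivity
  have hs1 : σ1 = α1 * (p + pst1) / (cV * ρ * θ) := by
    rw [hσ1, hρ1, show p + pst1 = R1 * r1 * θ by linarith]
    field_simp
  have hs2 : σ2 = α2 * (p + pst2) / (cV * ρ * θ) := by
    rw [hσ2, hρ2, show p + pst2 = R2 * r2 * θ by linarith]
    field_simp
  have hα2_eq : α2 = 1 - α1 := by linarith
  have hpp_eq : pp = p := by
    have hRρ : R * ρ = R1 * ρ1 + R2 * ρ2 := by
      rw [hR, div_mul_cancel₀ _ hρ_pos.ne']
    rw [hpp, hRρ, hρ1, hρ2]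
    linear_combination (-α1) * hp1 - α2 * hp2 + p * hαsum
  have hpm_nonpos : pm ≤ 0 := by
    rw [hpm, neg_nonpos]
    positivity
  rw [hε, hs1, hs2] at hb hc
  generalize cV * ρ * θ = K at *
  have hb_eq : b = pp + pm := by
    rw [hb, hpp_eq, hpm, hα2_eq]
    field_simp
    ring
  have hc_eq : c = -(pp * pm) := by
    rw [hc, hpp_eq, hpm, hα2_eq]
    field_simp
    ring
  have hpp_pos : 0 < pp := hpp_eq ▸ hp
  have hd_eq : d = (pp - pm) ^ 2 := by
    rw [hd, hb_eq, hc_eq]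
    ring
  have hdiff : 0 < pp - pm := by linarith
  have hsqrt : Real.sqrt d = pp - pm := by
    rw [hd_eq, Real.sqrt_sq hdiff.le]
  refine ⟨hb_eq, hc_eq, ?_, hpp_eq, hpp_pos, hpm_nonpos, hd_eq, ?_, ?_, ?_⟩
  · rw [hc_eq, neg_nonneg]
    exact mul_nonpos_of_nonneg_of_nonpos hpp_pos.le hpm_nonpos
  · rw [hd_eq]
    positivity
  · rw [hsqrt, hb_eq]
    ring
  · rw [hsqrt, hb_eq]
    ring
end

section
/- Under the state relations, the discriminant d of the quadratic pressure equation can be written as a quadratic polynomial in Δ* = p_{*2} − p_{*1}: d = [(α₂σ⁽¹⁾ − α₁σ⁽²⁾)² + 2(α₁σ⁽²⁾ + α₂σ⁽¹⁾) + 1]Δ*² + 2c_Vρθ[(α₂σ⁽¹⁾ − α₁σ⁽²⁾)(γ − 1) + σ⁽¹⁾ − σ⁽²⁾]Δ* + ((γ − 1)c_Vρθ)², and moreover d > 0. -/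
/-- the discriminant `d` of the quadratic pressure equation written as a
quadratic polynomial in `Δ* = p_{*2} − p_{*1}`, and its positivity. -/
theorem stmt2
    (R1 R2 cV1 cV2 pst1 pst2 e01 e02 α1 α2 r1 r2 θ p : ℝ)
    (hR1 : 0 < R1) (hR2 : 0 < R2) (hcV1 : 0 < cV1) (hcV2 : 0 < cV2)
    (hpst1 : 0 ≤ pst1) (hpst2 : 0 ≤ pst2)
    (hα1 : 0 < α1) (hα1' : α1 < 1) (hα2 : 0 < α2) (hα2' : α2 < 1)
    (hαsum : α1 + α2 = 1)
    (hr1 : 0 < r1) (hr2 : 0 < r2) (hθ : 0 < θ) (hp : 0 < p)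
    (hp1 : p = R1 * r1 * θ - pst1) (hp2 : p = R2 * r2 * θ - pst2)
    (ρ1 ρ2 ρ cV R γ ε0 σ1 σ2 ε : ℝ)
    (hρ1 : ρ1 = α1 * r1) (hρ2 : ρ2 = α2 * r2) (hρ : ρ = ρ1 + ρ2)
    (hcV : cV = (cV1 * ρ1 + cV2 * ρ2) / ρ) (hR : R = (R1 * ρ1 + R2 * ρ2) / ρ)
    (hγ : γ = R / cV + 1)
    (hε0 : ε0 = (ρ1 * e01 + ρ2 * e02) / ρ)
    (hσ1 : σ1 = R1 * ρ1 / (cV * ρ)) (hσ2 : σ2 = R2 * ρ2 / (cV * ρ))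
    (hε : ρ * (ε - ε0) = cV * ρ * θ + α1 * pst1 + α2 * pst2)
    (b c d Δ : ℝ)
    (hb : b = σ1 * (ρ * (ε - ε0) - pst1) + σ2 * (ρ * (ε - ε0) - pst2) - pst1 - pst2)
    (hc : c = σ1 * (ρ * (ε - ε0) - pst1) * pst2 + σ2 * (ρ * (ε - ε0) - pst2) * pst1
        - pst1 * pst2)
    (hd : d = b ^ 2 + 4 * c)
    (hΔ : Δ = pst2 - pst1) :
    d = ((α2 * σ1 - α1 * σ2) ^ 2 + 2 * (α1 * σ2 + α2 * σ1) + 1) * Δ ^ 2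
        + 2 * (cV * ρ * θ) * ((α2 * σ1 - α1 * σ2) * (γ - 1) + σ1 - σ2) * Δ
        + ((γ - 1) * (cV * ρ * θ)) ^ 2
      ∧ 0 < d := by
  have hρ1_pos : 0 < ρ1 := by rw [hρ1]; positivity
  have hρ2_pos : 0 < ρ2 := by rw [hρ2]; positivity
  have hρ_pos : 0 < ρ := by rw [hρ]; positivity
  have hcV_pos : 0 < cV := by rw [hcV]; positivity
  have hγσ : γ - 1 = σ1 + σ2 := by
    rw [hγ, hR, hσ1, hσ2]
    field_simp
    ring
  have hσT1 : σ1 * (cV * ρ * θ) = α1 * (p + pst1) := by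
    rw [hσ1, hp1, hρ1]
    field_simp
    ring
  have hσT2 : σ2 * (cV * ρ * θ) = α2 * (p + pst2) := by
    rw [hσ2, hp2, hρ2]
    field_simp
    ring
  have hT : 0 < cV * ρ * θ := by positivity
  rw [hε] at hb hc
  rw [hγσ]
  generalize cV * ρ * θ = T at *
  obtain rfl : α2 = 1 - α1 := by linarith
  have hσ1' : σ1 = α1 * (p + pst1) / T := by rw [← hσT1]; field_simp
  have hσ2' : σ2 = (1 - α1) * (p + pst2) / T := by rw [← hσT2]; field_simp
  have hroot : p ^ 2 - b * p - c = 0 := by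
    rw [hb, hc, hσ1', hσ2']
    field_simp
    ring
  have hgap : 2 * p - b
      = p + (1 - α1) * pst1 + α1 * pst2 + α1 * (1 - α1) * (pst2 - pst1) ^ 2 / T := by
    rw [hb, hσ1', hσ2']
    field_simp
    ring
  have hgap_pos : 0 < 2 * p - b := by rw [hgap]; positivity
  refine ⟨by rw [hd, hb, hc, hΔ]; ring, ?_⟩
  have hsq : d = (2 * p - b) ^ 2 := by rw [hd]; linear_combination -4 * hroot
  rw [hsq]
  positivity
end

section
/- Let α₁, α₂ be real numbers with α₁ + α₂ = 1, let σ⁽¹⁾ > 0, σ⁽²⁾ > 0 and a > 0 be real numbers, and consider the quadratic polynomial q(Δ) = [(α₂σ⁽¹⁾ − α₁σ⁽²⁾)² + 2(α₁σ⁽²⁾ + α₂σ⁽¹⁾) + 1]Δ² + 2a[(α₂σ⁽¹⁾ − α₁σ⁽²⁾)(σ⁽¹⁾ + σ⁽²⁾) + σ⁽¹⁾ − σ⁽²⁾]Δ + a²(σ⁽¹⁾ + σ⁽²⁾)² in the real variable Δ. Then its discriminant d₀ (the square of the middle coefficient minus four times the product of the leading and constant coefficients) equals −16a²σ⁽¹⁾σ⁽²⁾(σ⁽¹⁾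 + σ⁽²⁾ + 1) < 0, and consequently q(Δ) > 0 for every real Δ. -/
/-- A real quadratic with positive constant coefficient and negative discriminant is positive. -/
theorem quadratic_pos_of_discrim_neg {A B C : ℝ} (hC : 0 < C) (hd : B ^ 2 - 4 * (A * C) < 0)
    (x : ℝ) : 0 < A * x ^ 2 + B * x + C := by
  have hA : 0 < A := pos_of_mul_pos_left (by linarith [sq_nonneg B] : 0 < A * C) hC.le
  have h : 0 < 4 * A * (A * x ^ 2 + B * x + C) := by
    linarith [sq_nonneg (2 * A * x + B)]
  exact pos_of_mul_pos_right h (by positivity)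

/-- the discriminant `d₀` of the quadratic polynomial `q(Δ)` equals
`−16a²σ⁽¹⁾σ⁽²⁾(σ⁽¹⁾ + σ⁽²⁾ + 1) < 0`, hence `q(Δ) > 0` for all real `Δ`. -/
theorem stmt3 (α1 α2 σ1 σ2 a : ℝ)
    (hαsum : α1 + α2 = 1) (hσ1 : 0 < σ1) (hσ2 : 0 < σ2) (ha : 0 < a)
    (A B C : ℝ)
    (hA : A = (α2 * σ1 - α1 * σ2) ^ 2 + 2 * (α1 * σ2 + α2 * σ1) + 1)
    (hB : B = 2 * a * ((α2 * σ1 - α1 * σ2) * (σ1 + σ2) + σ1 - σ2))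
    (hC : C = a ^ 2 * (σ1 + σ2) ^ 2) :
    B ^ 2 - 4 * (A * C) = -(16 * a ^ 2 * σ1 * σ2 * (σ1 + σ2 + 1))
      ∧ B ^ 2 - 4 * (A * C) < 0
      ∧ ∀ Δ : ℝ, 0 < A * Δ ^ 2 + B * Δ + C := by
  have hd : B ^ 2 - 4 * (A * C) = -(16 * a ^ 2 * σ1 * σ2 * (σ1 + σ2 + 1)) := by
    obtain rfl : α2 = 1 - α1 := by linarith
    rw [hA, hB, hC]
    ring
  have hneg : B ^ 2 - 4 * (A * C) < 0 := by
    rw [hd, neg_lt_zero]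
    positivity
  have hCpos : 0 < C := by
    rw [hC]
    positivity
  exact ⟨hd, hneg, quadratic_pos_of_discrim_neg hCpos hneg⟩
end

section
/- Fix constants σ₁ > 0, σ₂ > 0, p_{*1} ≥ 0, p_{*2} ≥ 0, ε₀ ∈ ℝ, and set γ := 1 + σ₁ + σ₂. For ρ > 0 and ε ∈ ℝ define B(ρ,ε) := σ₁(ρ(ε−ε₀) − p_{*1}) + σ₂(ρ(ε−ε₀) − p_{*2}) − p_{*1} − p_{*2}, C(ρ,ε) := (σ₁p_{*2} + σ₂p_{*1})ρ(ε−ε₀) − γp_{*1}p_{*2}, D := B² + 4C and P := (B + √D)/2. Then at any point (ρ,ε) with ρ > 0 and D(ρ,ε) > 0, the partial derivatives of P exist and satisfy ∂_ρP + (P/ρ²)∂_εP = γ(P + p_{*1})(P + p_{*2})/(ρ√D), i.e., the squared speed of sound c_s² := ∂_ρP + (P/ρ²)∂_εP equals γ(P + p_{*1})(P + p_{*2})/(ρ√D). -/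
/-- The larger root `p = (b + √(b² + 4c)) / 2` of `p² - b p - c = 0` has derivative
`(b' p + c') / √(b² + 4c)` wherever the discriminant is positive. -/
theorem hasDerivAt_larger_root {b c : ℝ → ℝ} {b' c' t : ℝ} (hb : HasDerivAt b b' t)
    (hc : HasDerivAt c c' t) (hd : 0 < b t ^ 2 + 4 * c t) :
    HasDerivAt (fun s => (b s + Real.sqrt (b s ^ 2 + 4 * c s)) / 2)
      ((b' * ((b t + Real.sqrt (b t ^ 2 + 4 * c t)) / 2) + c') /
        Real.sqrt (b t ^ 2 + 4 * c t)) t := by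
  have h := (hb.add (((hb.pow 2).add (hc.const_mul 4)).sqrt hd.ne')).div_const 2
  refine h.congr_deriv ?_
  have hs := (Real.sqrt_pos.mpr hd).ne'
  simp only [Pi.add_apply, Pi.pow_apply]
  field_simp
  push_cast
  ring

/-- the squared speed of sound `c_s² = ∂_ρP + (P/ρ²)∂_εP` of the larger
root `P` of the quadratic pressure equation equals `γ(P + p_{*1})(P + p_{*2})/(ρ√D)`. -/
theorem stmt4 (σ1 σ2 pst1 pst2 e0 γ : ℝ)
    (hσ1 : 0 < σ1) (hσ2 : 0 < σ2) (hpst1 : 0 ≤ pst1) (hpst2 : 0 ≤ pst2)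
    (hγ : γ = 1 + σ1 + σ2)
    (B C D P : ℝ → ℝ → ℝ)
    (hB : ∀ ρ ε : ℝ, B ρ ε = σ1 * (ρ * (ε - e0) - pst1) + σ2 * (ρ * (ε - e0) - pst2)
        - pst1 - pst2)
    (hC : ∀ ρ ε : ℝ, C ρ ε = (σ1 * pst2 + σ2 * pst1) * (ρ * (ε - e0)) - γ * pst1 * pst2)
    (hD : ∀ ρ ε : ℝ, D ρ ε = (B ρ ε) ^ 2 + 4 * C ρ ε)
    (hP : ∀ ρ ε : ℝ, P ρ ε = (B ρ ε + Real.sqrt (D ρ ε)) / 2)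
    (ρ0 ε0 : ℝ) (hρ0 : 0 < ρ0) (hD0 : 0 < D ρ0 ε0) :
    ∃ dPdρ dPdε : ℝ,
      HasDerivAt (fun ρ => P ρ ε0) dPdρ ρ0 ∧
      HasDerivAt (fun ε => P ρ0 ε) dPdε ε0 ∧
      dPdρ + (P ρ0 ε0 / ρ0 ^ 2) * dPdε
        = γ * (P ρ0 ε0 + pst1) * (P ρ0 ε0 + pst2) / (ρ0 * Real.sqrt (D ρ0 ε0)) := by
  have hs : 0 < Real.sqrt (D ρ0 ε0) := Real.sqrt_pos.mpr hD0
  have hroot : P ρ0 ε0 ^ 2 = B ρ0 ε0 * P ρ0 ε0 + C ρ0 ε0 := by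
    have hsq := Real.sq_sqrt hD0.le
    have hDval := hD ρ0 ε0
    rw [hP]
    linear_combination (hsq + hDval) / 4
  have hderiv : ∀ (x y : ℝ → ℝ) (t z : ℝ), x t = ρ0 → y t = ε0 →
      HasDerivAt (fun s => x s * (y s - e0)) z t →
      HasDerivAt (fun s => P (x s) (y s))
        (((σ1 + σ2) * z * P ρ0 ε0 + (σ1 * pst2 + σ2 * pst1) * z) / Real.sqrt (D ρ0 ε0)) t := by
    intro x y t z hx hy hz
    have hb : HasDerivAt (fun s => B (x s) (y s)) ((σ1 + σ2) * z) t := by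
      simp only [hB]
      refine (((((hz.sub_const pst1).const_mul σ1).add
        ((hz.sub_const pst2).const_mul σ2)).sub_const pst1).sub_const pst2).congr_deriv ?_
      ring
    have hc : HasDerivAt (fun s => C (x s) (y s)) ((σ1 * pst2 + σ2 * pst1) * z) t := by
      simp only [hC]
      exact (hz.const_mul _).sub_const _
    have h := hasDerivAt_larger_root hb hc (by rw [hx, hy, ← hD]; exact hD0)
    simpa only [hP, ← hD, hx, hy] using h
  refine ⟨_, _, hderiv (fun ρ => ρ) (fun _ => ε0) ρ0 (ε0 - e0) rfl rfl ?_,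
    hderiv (fun _ => ρ0) (fun ε => ε) ε0 ρ0 rfl rfl ?_, ?_⟩
  · simpa using (hasDerivAt_id ρ0).mul_const (ε0 - e0)
  · simpa using ((hasDerivAt_id ε0).sub_const e0).const_mul ρ0
  · rw [hB, hC] at hroot
    subst hγ
    field_simp
    linear_combination -hroot
end

section
/- Under the state relations, the following identity holds: [(γ − 1)p + σ⁽¹⁾p_{*2} + σ⁽²⁾p_{*1}] · (ρ(ε − ε₀) + p) = γ(p + p_{*1})(p + p_{*2}). -/
/-- under the state relations,
`[(γ − 1)p + σ⁽¹⁾p_{*2} + σ⁽²⁾p_{*1}]·(ρ(ε − ε₀) + p) = γ(p + p_{*1})(p + p_{*2})`. -/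
theorem stmt6
    (R1 R2 cV1 cV2 pst1 pst2 e01 e02 α1 α2 r1 r2 θ p : ℝ)
    (hR1 : 0 < R1) (hR2 : 0 < R2) (hcV1 : 0 < cV1) (hcV2 : 0 < cV2)
    (hpst1 : 0 ≤ pst1) (hpst2 : 0 ≤ pst2)
    (hα1 : 0 < α1) (hα1' : α1 < 1) (hα2 : 0 < α2) (hα2' : α2 < 1)
    (hαsum : α1 + α2 = 1)
    (hr1 : 0 < r1) (hr2 : 0 < r2) (hθ : 0 < θ) (hp : 0 < p)
    (hp1 : p = R1 * r1 * θ - pst1) (hp2 : p = R2 * r2 * θ - pst2)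
    (ρ1 ρ2 ρ cV R γ ε0 σ1 σ2 ε : ℝ)
    (hρ1 : ρ1 = α1 * r1) (hρ2 : ρ2 = α2 * r2) (hρ : ρ = ρ1 + ρ2)
    (hcV : cV = (cV1 * ρ1 + cV2 * ρ2) / ρ) (hR : R = (R1 * ρ1 + R2 * ρ2) / ρ)
    (hγ : γ = R / cV + 1)
    (hε0 : ε0 = (ρ1 * e01 + ρ2 * e02) / ρ)
    (hσ1 : σ1 = R1 * ρ1 / (cV * ρ)) (hσ2 : σ2 = R2 * ρ2 / (cV * ρ))
    (hε : ρ * (ε - ε0) = cV * ρ * θ + α1 * pst1 + α2 * pst2) :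
    ((γ - 1) * p + σ1 * pst2 + σ2 * pst1) * (ρ * (ε - ε0) + p)
      = γ * (p + pst1) * (p + pst2) := by
  have hρ1_pos : 0 < ρ1 := hρ1 ▸ mul_pos hα1 hr1
  have hρ2_pos : 0 < ρ2 := hρ2 ▸ mul_pos hα2 hr2
  have hρ_pos : 0 < ρ := hρ ▸ add_pos hρ1_pos hρ2_pos
  have hcV_pos : 0 < cV := by rw [hcV]; positivity
  have hγC : (γ - 1) * (cV * ρ) = R1 * ρ1 + R2 * ρ2 := by rw [hγ, hR]; field_simp; ring
  have hσ1C : σ1 * (cV * ρ) = R1 * ρ1 := by rw [hσ1]; field_simp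
  have hσ2C : σ2 * (cV * ρ) = R2 * ρ2 := by rw [hσ2]; field_simp
  have hS1 : R1 * ρ1 * θ = α1 * (p + pst1) := by rw [hρ1]; linear_combination -α1 * hp1
  have hS2 : R2 * ρ2 * θ = α2 * (p + pst2) := by rw [hρ2]; linear_combination -α2 * hp2
  have hfirst : ((γ - 1) * p + σ1 * pst2 + σ2 * pst1) * (cV * ρ) * θ
      = (p + pst1) * (p + pst2) := by
    linear_combination p * θ * hγC + pst2 * θ * hσ1C + pst1 * θ * hσ2C
      + (p + pst2) * hS1 + (p + pst1) * hS2 + (p + pst1) * (p + pst2) * hαsum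
  have hsecond : ρ * (ε - ε0) + p = γ * (cV * ρ) * θ := by
    linear_combination hε - θ * hγC - hS1 - hS2 - p * hαsum
  rw [hsecond]
  linear_combination γ * hfirst
end

section
/- Let σ⁽¹⁾, σ⁽²⁾, p_{*1}, p_{*2}, ε₀, ε be real numbers and ρ > 0, and set γ := 1 + σ⁽¹⁾ + σ⁽²⁾, a_k := σ⁽ᵏ⁾(ρ(ε−ε₀) − p_{*k}), b := a₁ + a₂ − p_{*1} − p_{*2}, c := a₁p_{*2} + a₂p_{*1} − p_{*1}p_{*2}, d := b² + 4c. Suppose p₊ satisfies p₊² − bp₊ − c = 0, p₊ + p_{*1} > 0, p₊ + p_{*2} > 0, and 2p₊ − b = √d > 0, and that a₁/(p₊ + p_{*1})² + a₂/(p₊ + p_{*2})² ≠ 0. Then (γ/ρ) · [a₁/(p₊ + p_{*1})² + a₂/(p₊ + p_{*2})²]^{−1} = γ(p₊ + p_{*1})(p₊ + p_{*2}) / (ρ√d), i.e., the alternative radical-free formula for the squared speed of sound c_s² = (γ/ρ)·⟨σ⁽ᵏ⁾(ρ(ε−ε₀) − p_{*k})/(p₊ + p_{*k})²⟩^{−1}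 agrees with the compact formula c_s² = γ(p₊ + p_{*1})(p₊ + p_{*2})/(ρ√d). -/
/-- the radical-free formula for the squared speed of sound agrees with
the compact one:
`(γ/ρ)·[a₁/(p₊+p_{*1})² + a₂/(p₊+p_{*2})²]⁻¹ = γ(p₊+p_{*1})(p₊+p_{*2})/(ρ√d)`. -/
theorem stmt8 (σ1 σ2 pst1 pst2 e0 ε ρ γ a1 a2 b c d pp : ℝ)
    (hρ : 0 < ρ) (hγ : γ = 1 + σ1 + σ2)
    (ha1 : a1 = σ1 * (ρ * (ε - e0) - pst1)) (ha2 : a2 = σ2 * (ρ * (ε - e0) - pst2))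
    (hb : b = a1 + a2 - pst1 - pst2)
    (hc : c = a1 * pst2 + a2 * pst1 - pst1 * pst2)
    (hd : d = b ^ 2 + 4 * c)
    (hroot : pp ^ 2 - b * pp - c = 0)
    (h1 : 0 < pp + pst1) (h2 : 0 < pp + pst2)
    (hsq : 2 * pp - b = Real.sqrt d) (hsqpos : 0 < Real.sqrt d)
    (hne : a1 / (pp + pst1) ^ 2 + a2 / (pp + pst2) ^ 2 ≠ 0) :
    (γ / ρ) * (a1 / (pp + pst1) ^ 2 + a2 / (pp + pst2) ^ 2)⁻¹
      = γ * (pp + pst1) * (pp + pst2) / (ρ * Real.sqrt d) := by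
  have key : a1 / (pp + pst1) ^ 2 + a2 / (pp + pst2) ^ 2
      = Real.sqrt d / ((pp + pst1) * (pp + pst2)) := by
    rw [← hsq]
    have hx := h1.ne'
    have hy := h2.ne'
    rw [div_add_div _ _ (pow_ne_zero 2 hx) (pow_ne_zero 2 hy),
      div_eq_div_iff (by positivity) (by positivity)]
    subst hb hc
    linear_combination
      (-(pp + pst1) * (pp + pst2) * (2 * pp + pst1 + pst2)) * hroot
  rw [key, inv_div, div_mul_div_comm, mul_assoc γ]
end

section
/- Under the state relations, with γ_k := 1 + R_k/c_{Vk}, c_{pk} := γ_k c_{Vk}, squared component speeds of sound c_{sk}² := γ_k(γ_k − 1)c_{Vk}θ, the Wood speed of sound c_{sW} defined by 1/(ρc_{sW}²) := α₁/(r₁c_{s1}²) + α₂/(r₂c_{s2}²), the mixture heat capacity ρc_p := c_{p1}ρ₁ + c_{p2}ρ₂, ζ_k := 1/(c_{pk}r_k), and the mixture squared speed of sound c_s² := γ(p + p_{*1})(p + p_{*2})/(ρ(p₊ − p₋)), the following identity holds: 1/(ρc_s²) = 1/(ρc_{sW}²) + (c_{p1}ρ₁ · c_{p2}ρ₂ /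 (θ · ρc_p)) · (ζ₁ − ζ₂)². -/
/-- the Wood speed-of-sound comparison identity
`1/(ρc_s²) = 1/(ρc_{sW}²) + (c_{p1}ρ₁c_{p2}ρ₂/(θρc_p))(ζ₁ − ζ₂)²`. -/
theorem stmt10
    (R1 R2 cV1 cV2 pst1 pst2 e01 e02 α1 α2 r1 r2 θ p : ℝ)
    (hR1 : 0 < R1) (hR2 : 0 < R2) (hcV1 : 0 < cV1) (hcV2 : 0 < cV2)
    (hpst1 : 0 ≤ pst1) (hpst2 : 0 ≤ pst2)
    (hα1 : 0 < α1) (hα1' : α1 < 1) (hα2 : 0 < α2) (hα2' : α2 < 1)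
    (hαsum : α1 + α2 = 1)
    (hr1 : 0 < r1) (hr2 : 0 < r2) (hθ : 0 < θ) (hp : 0 < p)
    (hp1 : p = R1 * r1 * θ - pst1) (hp2 : p = R2 * r2 * θ - pst2)
    (ρ1 ρ2 ρ cV R γ : ℝ)
    (hρ1 : ρ1 = α1 * r1) (hρ2 : ρ2 = α2 * r2) (hρ : ρ = ρ1 + ρ2)
    (hcV : cV = (cV1 * ρ1 + cV2 * ρ2) / ρ) (hR : R = (R1 * ρ1 + R2 * ρ2) / ρ)
    (hγ : γ = R / cV + 1)
    (γ1 γ2 cp1 cp2 cs1sq cs2sq pp pm cssq csWsq ρcp ζ1 ζ2 : ℝ)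
    (hγ1 : γ1 = 1 + R1 / cV1) (hγ2 : γ2 = 1 + R2 / cV2)
    (hcp1 : cp1 = γ1 * cV1) (hcp2 : cp2 = γ2 * cV2)
    (hcs1 : cs1sq = γ1 * (γ1 - 1) * cV1 * θ) (hcs2 : cs2sq = γ2 * (γ2 - 1) * cV2 * θ)
    (hpp : pp = R * ρ * θ - (α1 * pst1 + α2 * pst2))
    (hpm : pm = -(α1 * pst2 + α2 * pst1 + α1 * α2 * (pst2 - pst1) ^ 2 / (cV * ρ * θ)))
    (hcssq : cssq = γ * (p + pst1) * (p + pst2) / (ρ * (pp - pm)))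
    (hcsW : 1 / (ρ * csWsq) = α1 / (r1 * cs1sq) + α2 / (r2 * cs2sq))
    (hρcp : ρcp = cp1 * ρ1 + cp2 * ρ2)
    (hζ1 : ζ1 = 1 / (cp1 * r1)) (hζ2 : ζ2 = 1 / (cp2 * r2)) :
    1 / (ρ * cssq) = 1 / (ρ * csWsq)
      + (cp1 * ρ1 * (cp2 * ρ2) / (θ * ρcp)) * (ζ1 - ζ2) ^ 2 := by
  have hρ1pos : 0 < ρ1 := hρ1 ▸ mul_pos hα1 hr1
  have hρ2pos : 0 < ρ2 := hρ2 ▸ mul_pos hα2 hr2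
  have hρpos : 0 < ρ := hρ ▸ add_pos hρ1pos hρ2pos
  have hA1 : p + pst1 = R1 * r1 * θ := by linarith
  have hA2 : p + pst2 = R2 * r2 * θ := by linarith
  have hcVρ : cV * ρ = cV1 * ρ1 + cV2 * ρ2 := by rw [hcV]; field_simp
  have hRρ : R * ρ = R1 * ρ1 + R2 * ρ2 := by rw [hR]; field_simp
  have hγ' : γ = ((cV1 + R1) * ρ1 + (cV2 + R2) * ρ2) / (cV1 * ρ1 + cV2 * ρ2) := by
    rw [hγ, hcV, hR]
    field_simp
    ring
  have hcp1' : cp1 = cV1 + R1 := by rw [hcp1, hγ1]; field_simp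
  have hcp2' : cp2 = cV2 + R2 := by rw [hcp2, hγ2]; field_simp
  have hcs1' : cs1sq = (cV1 + R1) * R1 * θ / cV1 := by rw [hcs1, hγ1]; field_simp; ring
  have hcs2' : cs2sq = (cV2 + R2) * R2 * θ / cV2 := by rw [hcs2, hγ2]; field_simp; ring
  have hgap : pp - pm = α1 * (R2 * r2 * θ) + α2 * (R1 * r1 * θ)
      + α1 * α2 * (R2 * r2 * θ - R1 * r1 * θ) ^ 2 / ((cV1 * ρ1 + cV2 * ρ2) * θ) := by
    have hΔ : pst2 - pst1 = R2 * r2 * θ - R1 * r1 * θ := by linarith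
    rw [hpp, hpm, hcVρ, hRρ, hΔ, hρ1, hρ2]
    linear_combination (α1 - α2) * hΔ
  have hinv : 1 / (ρ * cssq) = (pp - pm) / (γ * (R1 * r1 * θ) * (R2 * r2 * θ)) := by
    rw [hcssq, hA1, hA2]
    field_simp
  rw [hinv, hcsW, hgap, hγ', hρcp, hζ1, hζ2, hcs1', hcs2', hcp1', hcp2', hρ1, hρ2]
  field_simp
  ring
end

section
/- Under the state relations, with γ_k := 1 + R_k/c_{Vk}, squared component speeds of sound c_{sk}² := γ_k(γ_k − 1)c_{Vk}θ, the Wood speed of sound c_{sW} defined by 1/(ρc_{sW}²) := α₁/(r₁c_{s1}²) + α₂/(r₂c_{s2}²), and the mixture squared speed of sound c_s² := γ(p + p_{*1})(p + p_{*2})/(ρ(p₊ − p₋)), one has c_s² ≤ c_{sW}². -/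
/-- Two-term Cauchy–Schwarz inequality in Engel form, for weights summing to one. -/
theorem inv_add_le_sq_div_add_sq_div {a b u v : ℝ} (hab : a + b = 1) (hu : 0 < u) (hv : 0 < v) :
    1 / (u + v) ≤ a ^ 2 / u + b ^ 2 / v := by
  obtain rfl : b = 1 - a := by linarith
  rw [div_add_div _ _ hu.ne' hv.ne', div_le_div_iff₀ (by positivity) (by positivity)]
  nlinarith [sq_nonneg (a * v - (1 - a) * u)]

/-- the mixture squared speed of sound is bounded by the Wood one,
`c_s² ≤ c_{sW}²`. -/
theorem stmt11
    (R1 R2 cV1 cV2 pst1 pst2 e01 e02 α1 α2 r1 r2 θ p : ℝ)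
    (hR1 : 0 < R1) (hR2 : 0 < R2) (hcV1 : 0 < cV1) (hcV2 : 0 < cV2)
    (hpst1 : 0 ≤ pst1) (hpst2 : 0 ≤ pst2)
    (hα1 : 0 < α1) (hα1' : α1 < 1) (hα2 : 0 < α2) (hα2' : α2 < 1)
    (hαsum : α1 + α2 = 1)
    (hr1 : 0 < r1) (hr2 : 0 < r2) (hθ : 0 < θ) (hp : 0 < p)
    (hp1 : p = R1 * r1 * θ - pst1) (hp2 : p = R2 * r2 * θ - pst2)
    (ρ1 ρ2 ρ cV R γ : ℝ)
    (hρ1 : ρ1 = α1 * r1) (hρ2 : ρ2 = α2 * r2) (hρ : ρ = ρ1 + ρ2)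
    (hcV : cV = (cV1 * ρ1 + cV2 * ρ2) / ρ) (hR : R = (R1 * ρ1 + R2 * ρ2) / ρ)
    (hγ : γ = R / cV + 1)
    (γ1 γ2 cs1sq cs2sq pp pm cssq csWsq : ℝ)
    (hγ1 : γ1 = 1 + R1 / cV1) (hγ2 : γ2 = 1 + R2 / cV2)
    (hcs1 : cs1sq = γ1 * (γ1 - 1) * cV1 * θ) (hcs2 : cs2sq = γ2 * (γ2 - 1) * cV2 * θ)
    (hpp : pp = R * ρ * θ - (α1 * pst1 + α2 * pst2))
    (hpm : pm = -(α1 * pst2 + α2 * pst1 + α1 * α2 * (pst2 - pst1) ^ 2 / (cV * ρ * θ)))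
    (hcssq : cssq = γ * (p + pst1) * (p + pst2) / (ρ * (pp - pm)))
    (hcsW : 1 / (ρ * csWsq) = α1 / (r1 * cs1sq) + α2 / (r2 * cs2sq))
    :
    cssq ≤ csWsq := by
  have hP1 : p + pst1 = R1 * r1 * θ := by linarith
  have hP2 : p + pst2 = R2 * r2 * θ := by linarith
  have hρ1pos : 0 < ρ1 := hρ1 ▸ mul_pos hα1 hr1
  have hρ2pos : 0 < ρ2 := hρ2 ▸ mul_pos hα2 hr2
  have hρpos : 0 < ρ := by linarith
  have hcVρ : cV * ρ = cV1 * ρ1 + cV2 * ρ2 := by rw [hcV, div_mul_cancel₀ _ hρpos.ne']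
  have hRρ : R * ρ = R1 * ρ1 + R2 * ρ2 := by rw [hR, div_mul_cancel₀ _ hρpos.ne']
  have hcVpos : 0 < cV := by rw [hcV]; positivity
  have hRpos : 0 < R := by rw [hR]; positivity
  have hγρ : γ * (cV * ρ * θ) = (cV * ρ + R * ρ) * θ := by rw [hγ]; field_simp; ring
  have hγpos : 0 < γ := by rw [hγ]; positivity
  have hP1pos : 0 < p + pst1 := by linarith
  have hP2pos : 0 < p + pst2 := by linarith
  have hRρθ : R * ρ * θ = α1 * (p + pst1) + α2 * (p + pst2) := by
    rw [hRρ, hP1, hP2, hρ1, hρ2]; ring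
  have hdiff : pp - pm = α1 * (p + pst2) + α2 * (p + pst1)
      + α1 * α2 * (pst2 - pst1) ^ 2 / (cV * ρ * θ) := by
    rw [hpp, hpm, hRρθ]; ring
  have hdiffpos : 0 < pp - pm := by rw [hdiff]; positivity
  have hmix : 1 / (ρ * cssq)
      = α1 / (p + pst1) + α2 / (p + pst2) - 1 / (cV * ρ * θ + R * ρ * θ) := by
    have hC : 0 < cV * ρ * θ := by positivity
    have hγ' : γ = (cV * ρ * θ + R * ρ * θ) / (cV * ρ * θ) := by
      rw [eq_div_iff hC.ne', hγρ]; ring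
    have hinv : 1 / (ρ * cssq) = (pp - pm) / (γ * (p + pst1) * (p + pst2)) := by
      rw [hcssq]; field_simp
    have hd : pst2 - pst1 = (p + pst2) - (p + pst1) := by ring
    rw [hinv, hdiff, hγ', hRρθ, hd]
    generalize cV * ρ * θ = C at hC ⊢
    generalize p + pst1 = x at hP1pos ⊢
    generalize p + pst2 = y at hP2pos ⊢
    obtain rfl : α2 = 1 - α1 := by linarith
    have hE : C + (α1 * x + (1 - α1) * y) ≠ 0 := by positivity
    field_simp
    ring
  have hwood : 1 / (ρ * csWsq) = α1 / (p + pst1) + α2 / (p + pst2)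
      - (α1 ^ 2 / ((cV1 + R1) * ρ1 * θ) + α2 ^ 2 / ((cV2 + R2) * ρ2 * θ)) := by
    rw [hcsW, hcs1, hcs2, hγ1, hγ2, hP1, hP2, hρ1, hρ2]
    have h (a c r S : ℝ) (ha : 0 < a) (hc : 0 < c) (hr : 0 < r) (hS : 0 < S) :
        a / (r * ((1 + S / c) * (1 + S / c - 1) * c * θ))
          = a / (S * r * θ) - a ^ 2 / ((c + S) * (a * r) * θ) := by
      rw [add_sub_cancel_left]
      field_simp
      ring
    rw [h α1 cV1 r1 R1 hα1 hcV1 hr1 hR1, h α2 cV2 r2 R2 hα2 hcV2 hr2 hR2]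
    ring
  have hle : 1 / (ρ * csWsq) ≤ 1 / (ρ * cssq) := by
    have hsum : cV * ρ * θ + R * ρ * θ = (cV1 + R1) * ρ1 * θ + (cV2 + R2) * ρ2 * θ := by
      rw [hcVρ, hRρ]; ring
    rw [hmix, hwood, hsum]
    exact sub_le_sub_left (inv_add_le_sq_div_add_sq_div hαsum (by positivity) (by positivity)) _
  have hwoodpos : 0 < ρ * csWsq := by
    rw [← one_div_pos, hcsW, hcs1, hcs2, hγ1, hγ2]
    simp only [add_sub_cancel_left]
    positivity
  have hmixpos : 0 < ρ * cssq := by rw [hcssq]; positivity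
  exact le_of_mul_le_mul_left ((one_div_le_one_div hwoodpos hmixpos).1 hle) hρpos
end

section
/- Under the state relations, with the mixture squared speed of sound c_s² := γ(p + p_{*1})(p + p_{*2})/(ρ(p₊ − p₋)), the following exact identity holds: ρ(p₊ − p₋)·(c_s² − γ(γ − 1)c_Vθ) = −γ²α₁α₂Δ*², equivalently γ(p + p_{*1})(p + p_{*2}) − γ(γ − 1)c_Vθ·ρ(p₊ − p₋) = −γ²α₁α₂Δ*². -/
/-- the exact identity
`ρ(p₊ − p₋)(c_s² − γ(γ − 1)c_Vθ) = −γ²α₁α₂Δ*²`, equivalently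
`γ(p + p_{*1})(p + p_{*2}) − γ(γ − 1)c_Vθ·ρ(p₊ − p₋) = −γ²α₁α₂Δ*²`. -/
theorem stmt12
    (R1 R2 cV1 cV2 pst1 pst2 e01 e02 α1 α2 r1 r2 θ p : ℝ)
    (hR1 : 0 < R1) (hR2 : 0 < R2) (hcV1 : 0 < cV1) (hcV2 : 0 < cV2)
    (hpst1 : 0 ≤ pst1) (hpst2 : 0 ≤ pst2)
    (hα1 : 0 < α1) (hα1' : α1 < 1) (hα2 : 0 < α2) (hα2' : α2 < 1)
    (hαsum : α1 + α2 = 1)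
    (hr1 : 0 < r1) (hr2 : 0 < r2) (hθ : 0 < θ) (hp : 0 < p)
    (hp1 : p = R1 * r1 * θ - pst1) (hp2 : p = R2 * r2 * θ - pst2)
    (ρ1 ρ2 ρ cV R γ : ℝ)
    (hρ1 : ρ1 = α1 * r1) (hρ2 : ρ2 = α2 * r2) (hρ : ρ = ρ1 + ρ2)
    (hcV : cV = (cV1 * ρ1 + cV2 * ρ2) / ρ) (hR : R = (R1 * ρ1 + R2 * ρ2) / ρ)
    (hγ : γ = R / cV + 1)
    (pp pm cssq Δ : ℝ)
    (hpp : pp = R * ρ * θ - (α1 * pst1 + α2 * pst2))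
    (hpm : pm = -(α1 * pst2 + α2 * pst1 + α1 * α2 * (pst2 - pst1) ^ 2 / (cV * ρ * θ)))
    (hcssq : cssq = γ * (p + pst1) * (p + pst2) / (ρ * (pp - pm)))
    (hΔ : Δ = pst2 - pst1) :
    ρ * (pp - pm) * (cssq - γ * (γ - 1) * cV * θ) = -(γ ^ 2 * α1 * α2 * Δ ^ 2)
      ∧ γ * (p + pst1) * (p + pst2) - γ * (γ - 1) * cV * θ * (ρ * (pp - pm))
        = -(γ ^ 2 * α1 * α2 * Δ ^ 2) := by
  have hρ1pos : 0 < ρ1 := hρ1 ▸ mul_pos hα1 hr1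
  have hρ2pos : 0 < ρ2 := hρ2 ▸ mul_pos hα2 hr2
  have hρpos : 0 < ρ := hρ ▸ add_pos hρ1pos hρ2pos
  have hcVpos : 0 < cV := by rw [hcV]; positivity
  have hpressure : R * ρ * θ = α1 * (p + pst1) + α2 * (p + pst2) := by
    have hRρ : R * ρ = R1 * ρ1 + R2 * ρ2 := by rw [hR]; field_simp
    rw [hRρ, hρ1, hρ2]
    linear_combination -α1 * hp1 - α2 * hp2
  have hpp_eq : pp = p := by
    rw [hpp, hpressure]
    linear_combination p * hαsum
  set K := α1 * α2 * (pst2 - pst1) ^ 2 / (cV * ρ * θ) with hK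
  have hKnonneg : 0 ≤ K := by positivity
  have hKmul : K * (cV * ρ * θ) = α1 * α2 * Δ ^ 2 := by
    rw [hK, hΔ]; field_simp
  have hγcV : (γ - 1) * cV = R := by rw [hγ]; field_simp; ring
  have hgap : pp - pm = α2 * (p + pst1) + α1 * (p + pst2) + K := by
    rw [hpp_eq, hpm]
    linear_combination -p * hαsum
  have hgap_pos : 0 < pp - pm := by rw [hgap]; positivity
  have hidentity : γ * (p + pst1) * (p + pst2) - γ * (γ - 1) * cV * θ * (ρ * (pp - pm))
      = -(γ ^ 2 * α1 * α2 * Δ ^ 2) := by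
    have hS : (γ - 1) * cV * θ * ρ = α1 * (p + pst1) + α2 * (p + pst2) := by
      rw [hγcV, ← hpressure]; ring
    have hα : α2 = 1 - α1 := by linarith
    have hproduct : (α1 * (p + pst1) + α2 * (p + pst2)) * (α2 * (p + pst1) + α1 * (p + pst2))
        = (p + pst1) * (p + pst2) + α1 * α2 * Δ ^ 2 := by
      rw [hΔ, hα]; ring
    rw [hgap]
    linear_combination -γ * (α2 * (p + pst1) + α1 * (p + pst2)) * hS - γ * hproduct
      - γ * (γ - 1) * hKmul
  refine ⟨?_, hidentity⟩
  rw [← hidentity, hcssq]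
  field_simp
end

section
/- Under the state relations, with γ_k := 1 + R_k/c_{Vk}, squared component speeds of sound c_{sk}² := γ_k(γ_k − 1)c_{Vk}θ, and the mixture squared speed of sound c_s² := γ(p + p_{*1})(p + p_{*2})/(ρ(p₊ − p₋)), the following chain of inequalities and the final equality hold: c_s² ≤ γ(γ − 1)c_Vθ ≤ (ρ₁c_{s1}² + ρ₂c_{s2}²)/ρ = (α₁γ₁(p + p_{*1}) + α₂γ₂(p + p_{*2}))/ρ. -/
/-- Sedrakyan's inequality for two terms. -/
theorem add_sq_div_add_le_add_sq_div {a b c d : ℝ} (hc : 0 < c) (hd : 0 < d) :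
    (a + b) ^ 2 / (c + d) ≤ a ^ 2 / c + b ^ 2 / d := by
  rw [div_add_div _ _ hc.ne' hd.ne', div_le_div_iff₀ (by positivity) (by positivity)]
  nlinarith [sq_nonneg (a * d - b * c)]

/-- The product of two positive numbers over a weighted mean of them, possibly enlarged, is at most
the mean with the weights exchanged. -/
theorem mul_div_weighted_mean_le {a b x y t : ℝ} (ha : 0 < a) (hb : 0 < b) (hx : 0 < x)
    (hy : 0 < y) (hxy : x + y = 1) (ht : 0 ≤ t) :
    a * b / (x * b + y * a + t) ≤ x * a + y * b := by
  rw [div_le_iff₀ (by positivity)]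
  have h : (x * a + y * b) * (x * b + y * a) = a * b + x * y * (a - b) ^ 2 := by
    obtain rfl : y = 1 - x := by linarith
    ring
  have h1 : 0 ≤ x * y * (a - b) ^ 2 := by positivity
  have h2 : 0 ≤ (x * a + y * b) * t := by positivity
  linarith


/-- the chain of comparisons
`c_s² ≤ γ(γ − 1)c_Vθ ≤ (ρ₁c_{s1}² + ρ₂c_{s2}²)/ρ = (α₁γ₁(p + p_{*1}) + α₂γ₂(p + p_{*2}))/ρ`. -/
theorem stmt13
    (R1 R2 cV1 cV2 pst1 pst2 e01 e02 α1 α2 r1 r2 θ p : ℝ)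
    (hR1 : 0 < R1) (hR2 : 0 < R2) (hcV1 : 0 < cV1) (hcV2 : 0 < cV2)
    (hpst1 : 0 ≤ pst1) (hpst2 : 0 ≤ pst2)
    (hα1 : 0 < α1) (hα1' : α1 < 1) (hα2 : 0 < α2) (hα2' : α2 < 1)
    (hαsum : α1 + α2 = 1)
    (hr1 : 0 < r1) (hr2 : 0 < r2) (hθ : 0 < θ) (hp : 0 < p)
    (hp1 : p = R1 * r1 * θ - pst1) (hp2 : p = R2 * r2 * θ - pst2)
    (ρ1 ρ2 ρ cV R γ : ℝ)
    (hρ1 : ρ1 = α1 * r1) (hρ2 : ρ2 = α2 * r2) (hρ : ρ = ρ1 + ρ2)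
    (hcV : cV = (cV1 * ρ1 + cV2 * ρ2) / ρ) (hR : R = (R1 * ρ1 + R2 * ρ2) / ρ)
    (hγ : γ = R / cV + 1)
    (γ1 γ2 cs1sq cs2sq pp pm cssq : ℝ)
    (hγ1 : γ1 = 1 + R1 / cV1) (hγ2 : γ2 = 1 + R2 / cV2)
    (hcs1 : cs1sq = γ1 * (γ1 - 1) * cV1 * θ) (hcs2 : cs2sq = γ2 * (γ2 - 1) * cV2 * θ)
    (hpp : pp = R * ρ * θ - (α1 * pst1 + α2 * pst2))
    (hpm : pm = -(α1 * pst2 + α2 * pst1 + α1 * α2 * (pst2 - pst1) ^ 2 / (cV * ρ * θ)))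
    (hcssq : cssq = γ * (p + pst1) * (p + pst2) / (ρ * (pp - pm))) :
    cssq ≤ γ * (γ - 1) * cV * θ ∧
    γ * (γ - 1) * cV * θ ≤ (ρ1 * cs1sq + ρ2 * cs2sq) / ρ ∧
    (ρ1 * cs1sq + ρ2 * cs2sq) / ρ
      = (α1 * γ1 * (p + pst1) + α2 * γ2 * (p + pst2)) / ρ := by
  have hρ1pos : 0 < ρ1 := by rw [hρ1]; positivity
  have hρ2pos : 0 < ρ2 := by rw [hρ2]; positivity
  have hρpos : 0 < ρ := by rw [hρ]; positivity
  have hcVpos : 0 < cV := by rw [hcV]; positivity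
  have hRpos : 0 < R := by rw [hR]; positivity
  have hγpos : 0 < γ := by rw [hγ]; positivity
  have hA : p + pst1 = R1 * r1 * θ := by linarith
  have hB : p + pst2 = R2 * r2 * θ := by linarith
  have hRρ : R * ρ = R1 * ρ1 + R2 * ρ2 := by rw [hR]; field_simp
  have hcVρ : cV * ρ = cV1 * ρ1 + cV2 * ρ2 := by rw [hcV]; field_simp
  have hS : R * ρ * θ = α1 * (p + pst1) + α2 * (p + pst2) := by
    rw [hRρ, hA, hB, hρ1, hρ2]; ring
  have hmid : γ * (γ - 1) * cV * θ = γ * (R * ρ * θ) / ρ := by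
    have h : γ - 1 = R / cV := by linarith
    rw [h]; field_simp
  have hcs1' : ρ1 * cs1sq = α1 * γ1 * (p + pst1) := by
    have h : γ1 - 1 = R1 / cV1 := by linarith
    rw [hcs1, h, hA, hρ1]; field_simp
  have hcs2' : ρ2 * cs2sq = α2 * γ2 * (p + pst2) := by
    have h : γ2 - 1 = R2 / cV2 := by linarith
    rw [hcs2, h, hB, hρ2]; field_simp
  refine ⟨?_, ?_, by rw [hcs1', hcs2']⟩
  · have hdiff : pp - pm = α1 * (p + pst2) + α2 * (p + pst1)
        + α1 * α2 * (pst2 - pst1) ^ 2 / (cV * ρ * θ) := by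
      rw [hpp, hpm, hS]
      ring
    have hle : (p + pst1) * (p + pst2) / (pp - pm) ≤ R * ρ * θ := by
      rw [hdiff, hS]
      exact mul_div_weighted_mean_le (by positivity) (by positivity) hα1 hα2 hαsum (by positivity)
    calc cssq = γ * ((p + pst1) * (p + pst2) / (pp - pm)) / ρ := by
          rw [hcssq, mul_comm ρ, ← div_div]; ring
      _ ≤ γ * (R * ρ * θ) / ρ := by gcongr
      _ = γ * (γ - 1) * cV * θ := hmid.symm
  · have hsed := add_sq_div_add_le_add_sq_div (a := R1 * ρ1) (b := R2 * ρ2)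
      (mul_pos hcV1 hρ1pos) (mul_pos hcV2 hρ2pos)
    have hleft : γ * (R * ρ * θ)
        = θ * (R1 * ρ1 + R2 * ρ2 + (R1 * ρ1 + R2 * ρ2) ^ 2 / (cV1 * ρ1 + cV2 * ρ2)) := by
      rw [← hRρ, ← hcVρ, hγ]; field_simp
      ring
    have hright : ρ1 * cs1sq + ρ2 * cs2sq = θ * (R1 * ρ1 + R2 * ρ2
        + ((R1 * ρ1) ^ 2 / (cV1 * ρ1) + (R2 * ρ2) ^ 2 / (cV2 * ρ2))) := by
      rw [hcs1, hcs2, hγ1, hγ2]; field_simp; ring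
    rw [hmid, hleft, hright]
    gcongr
end

section
/- Let R₁, R₂ > 0, c_{V1}, c_{V2} > 0, p_{*1}, p_{*2} ≥ 0, ε₀₁, ε₀₂ ∈ ℝ, ρ₁, ρ₂ > 0 and p be given with p + p_{*1} > 0 and p + p_{*2} > 0, and set ρ := ρ₁ + ρ₂, c_V := (c_{V1}ρ₁ + c_{V2}ρ₂)/ρ, ε₀ := (ρ₁ε₀₁ + ρ₂ε₀₂)/ρ, σ⁽ᵏ⁾ := R_kρ_k/(c_Vρ). Define θ := [R₁ρ₁/(p + p_{*1}) + R₂ρ₂/(p + p_{*2})]^{−1} and α_k := R_kρ_kθ/(p + p_{*k}), r_k := ρ_k/α_k for k = 1, 2. Then (i) α₁ + α₂ = 1; (ii) R_k r_k θ − p_{*k} = p for k = 1, 2; and (iii) if additionally ε ∈ ℝ is such that p satisfies the rational pressure equation σ⁽¹⁾(ρ(ε−ε₀) − p_{*1})/(p + p_{*1}) + σ⁽²⁾(ρ(ε−ε₀) − p_{*2})/(p + p_{*2}) = 1, then ρ(ε − ε₀) = c_Vρθ + α₁p_{*1} + α₂p_{*2}, and hence α₁r₁ε₁ + α₂r₂ε₂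 = ρε where ε_k := c_{Vk}θ + p_{*k}/r_k + ε₀ₖ. -/
/-- equivalence of the quasi-homogeneous form with the heterogeneous one:
`α₁ + α₂ = 1`, `R_k r_k θ − p_{*k} = p`, and the rational pressure equation implies
`ρ(ε − ε₀) = c_Vρθ + α₁p_{*1} + α₂p_{*2}` and `⟨α_k r_k ε_k⟩ = ρε`. -/
theorem stmt14 (R1 R2 cV1 cV2 pst1 pst2 e01 e02 ρ1 ρ2 p : ℝ)
    (hR1 : 0 < R1) (hR2 : 0 < R2) (hcV1 : 0 < cV1) (hcV2 : 0 < cV2)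
    (hpst1 : 0 ≤ pst1) (hpst2 : 0 ≤ pst2)
    (hρ1 : 0 < ρ1) (hρ2 : 0 < ρ2)
    (hp1 : 0 < p + pst1) (hp2 : 0 < p + pst2)
    (ρ cV ε0 σ1 σ2 θ α1 α2 r1 r2 : ℝ)
    (hρ : ρ = ρ1 + ρ2)
    (hcV : cV = (cV1 * ρ1 + cV2 * ρ2) / ρ)
    (hε0 : ε0 = (ρ1 * e01 + ρ2 * e02) / ρ)
    (hσ1 : σ1 = R1 * ρ1 / (cV * ρ)) (hσ2 : σ2 = R2 * ρ2 / (cV * ρ))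
    (hθ : θ = (R1 * ρ1 / (p + pst1) + R2 * ρ2 / (p + pst2))⁻¹)
    (hα1 : α1 = R1 * ρ1 * θ / (p + pst1)) (hα2 : α2 = R2 * ρ2 * θ / (p + pst2))
    (hr1 : r1 = ρ1 / α1) (hr2 : r2 = ρ2 / α2) :
    α1 + α2 = 1 ∧
    R1 * r1 * θ - pst1 = p ∧ R2 * r2 * θ - pst2 = p ∧
    ∀ ε : ℝ,
      σ1 * (ρ * (ε - ε0) - pst1) / (p + pst1)
        + σ2 * (ρ * (ε - ε0) - pst2) / (p + pst2) = 1 →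
      ρ * (ε - ε0) = cV * ρ * θ + α1 * pst1 + α2 * pst2 ∧
      α1 * r1 * (cV1 * θ + pst1 / r1 + e01)
        + α2 * r2 * (cV2 * θ + pst2 / r2 + e02) = ρ * ε := by
  have hρpos : 0 < ρ := by rw [hρ]; positivity
  have hcVρ : cV * ρ = cV1 * ρ1 + cV2 * ρ2 := by
    rw [hcV]; exact div_mul_cancel₀ _ hρpos.ne'
  have hε0ρ : ρ * ε0 = ρ1 * e01 + ρ2 * e02 := by
    rw [hε0]; exact mul_div_cancel₀ _ hρpos.ne'
  have hcVρpos : 0 < cV * ρ := by rw [hcVρ]; positivity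
  have hθpos : 0 < θ := by rw [hθ]; positivity
  have hα1pos : 0 < α1 := by rw [hα1]; positivity
  have hα2pos : 0 < α2 := by rw [hα2]; positivity
  have hsum : α1 + α2 = 1 := by
    have hne : R1 * ρ1 / (p + pst1) + R2 * ρ2 / (p + pst2) ≠ 0 := by positivity
    calc α1 + α2 = (R1 * ρ1 / (p + pst1) + R2 * ρ2 / (p + pst2)) * θ := by
          rw [hα1, hα2]; ring
      _ = 1 := by rw [hθ]; exact mul_inv_cancel₀ hne
  have hα1p : α1 * (p + pst1) = R1 * ρ1 * θ := by
    rw [hα1]; exact div_mul_cancel₀ _ hp1.ne'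
  have hα2p : α2 * (p + pst2) = R2 * ρ2 * θ := by
    rw [hα2]; exact div_mul_cancel₀ _ hp2.ne'
  refine ⟨hsum, ?_, ?_, fun ε hε => ?_⟩
  · rw [hr1]
    field_simp
    linarith
  · rw [hr2]
    field_simp
    linarith
  · have hpressure : α1 * (ρ * (ε - ε0) - pst1) + α2 * (ρ * (ε - ε0) - pst2) = cV * ρ * θ := by
      calc α1 * (ρ * (ε - ε0) - pst1) + α2 * (ρ * (ε - ε0) - pst2)
          = cV * ρ * θ * (σ1 * (ρ * (ε - ε0) - pst1) / (p + pst1)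
              + σ2 * (ρ * (ε - ε0) - pst2) / (p + pst2)) := by
            have hσ1' : cV * ρ * σ1 = R1 * ρ1 := by
              rw [hσ1]; exact mul_div_cancel₀ _ hcVρpos.ne'
            have hσ2' : cV * ρ * σ2 = R2 * ρ2 := by
              rw [hσ2]; exact mul_div_cancel₀ _ hcVρpos.ne'
            rw [hα1, hα2, ← hσ1', ← hσ2']
            ring
        _ = cV * ρ * θ := by rw [hε, mul_one]
    have henergy : ρ * (ε - ε0) = cV * ρ * θ + α1 * pst1 + α2 * pst2 := by
      linear_combination hpressure - ρ * (ε - ε0) * hsum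
    refine ⟨henergy, ?_⟩
    have hm1 : α1 * r1 = ρ1 := by rw [hr1]; exact mul_div_cancel₀ _ hα1pos.ne'
    have hm2 : α2 * r2 = ρ2 := by rw [hr2]; exact mul_div_cancel₀ _ hα2pos.ne'
    have hq1 : ρ1 * (pst1 / r1) = α1 * pst1 := by rw [hr1]; field_simp
    have hq2 : ρ2 * (pst2 / r2) = α2 * pst2 := by rw [hr2]; field_simp
    rw [hm1, hm2]
    linear_combination hq1 + hq2 - henergy - θ * hcVρ - hε0ρ
end

section
/- Fix h > 0 and Δt > 0. Let ρ, ρ̂, u, û, p : ℤ → ℝ be main-grid functions and j, Π : ℤ → ℝ be half-grid functions, and suppose that at every i ∈ ℤ the discrete mixture mass balance δ_tρ + δ*j = 0 and the discrete momentum balance δ_t(ρu) + δ*(j[u] + [p]) = δ*Π hold. Then at every i ∈ ℤ the discrete kinetic energy balance holds: (1/2)δ_t(ρu²) − (Δt/2)ρ̂(δ_tu)² + (1/2)δ*(j·u₋u₊) + (δ*[p])·u = (δ*Π)·u. -/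
/-- Average of a main-grid function at the half-grid node `i + 1/2`. -/
noncomputable def avgM (v : ℤ → ℝ) : ℤ → ℝ := fun i => (v i + v (i + 1)) / 2

/-- Difference quotient of a main-grid function at the half-grid node `i + 1/2`. -/
noncomputable def dM (h : ℝ) (v : ℤ → ℝ) : ℤ → ℝ := fun i => (v (i + 1) - v i) / h

/-- Average of a half-grid function at the main-grid node `i`. -/
noncomputable def avgS (w : ℤ → ℝ) : ℤ → ℝ := fun i => (w (i - 1) + w i) / 2

/-- Difference quotient of a half-grid function at the main-grid node `i`. -/
noncomputable def dS (h : ℝ) (w : ℤ → ℝ) : ℤ → ℝ := fun i => (w i - w (i - 1)) / h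

/-- Time difference quotient of a pair of time levels of a grid function. -/
noncomputable def dt (Δt : ℝ) (y yh : ℤ → ℝ) : ℤ → ℝ := fun i => (yh i - y i) / Δt

/-- the discrete mass and momentum balances imply the discrete kinetic
energy balance
`(1/2)δ_t(ρu²) − (Δt/2)ρ̂(δ_tu)² + (1/2)δ*(j u₋u₊) + (δ*[p])u = (δ*Pv)u`. -/
theorem stmt17 (h Δt : ℝ) (hh : 0 < h) (hΔt : 0 < Δt)
    (ρ ρh u uh p : ℤ → ℝ) (j Pv : ℤ → ℝ)
    (hmass : ∀ i : ℤ, dt Δt ρ ρh i + dS h j i = 0)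
    (hmom : ∀ i : ℤ, dt Δt (fun n => ρ n * u n) (fun n => ρh n * uh n) i
      + dS h (fun n => j n * avgM u n + avgM p n) i = dS h Pv i) :
    ∀ i : ℤ,
      (1 / 2) * dt Δt (fun n => ρ n * u n ^ 2) (fun n => ρh n * uh n ^ 2) i
        - (Δt / 2) * ρh i * (dt Δt u uh i) ^ 2
        + (1 / 2) * dS h (fun n => j n * (u n * u (n + 1))) i
        + dS h (avgM p) i * u i
      = dS h Pv i * u i := by
  intro i
  have hm := hmass i
  have hp := hmom i
  simp only [dt, dS, avgM, sub_add_cancel] at hm hp ⊢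
  have hΔt' : Δt ≠ 0 := hΔt.ne'
  have htime : (Δt / 2) * ρh i * ((uh i - u i) / Δt) ^ 2
      = ρh i * (uh i - u i) ^ 2 / 2 / Δt := by
    field_simp
  rw [htime]
  linear_combination u i * hp - u i ^ 2 / 2 * hm
end

section
/- Fix h > 0 and Δt > 0. Let ρ, ρ̂, u, û, p, e, ê : ℤ → ℝ be main-grid functions (e represents ρε and ê its new time level) and w, q, Π, Q : ℤ → ℝ be half-grid functions, and set j := [ρ]([u] − w). Suppose that at every i ∈ ℤ the following discrete equations hold: (mass) δ_tρ + δ*j = 0; (momentum) δ_t(ρu) + δ*(j[u] + [p]) = δ*Π; (total energy) δ_t((1/2)ρu² + e) + δ*{((1/2)[ρ]u₋u₊ + [e] + [p])([u] − w) − (1/4)h²(δp)(δu)} = δ*(−q + Π[u]) + [Q]*. Then at every i ∈ ℤ the discrete internal energy balance holds: δ_te + (Δt/2)ρ̂(δ_tu)² + δ*([e]([u] − w)) = −δ*q + [Π·δu]* − p·δ*([u] − w) + [w·δp]* + [Q]*. -/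
/-- the discrete mass, momentum and total energy balances imply the
discrete internal energy balance
`δ_te + (Δt/2)ρ̂(δ_tu)² + δ*([e]([u] − w)) = −δ*q + [Πδu]* − pδ*([u] − w) + [wδp]* + [Q]*`. -/
theorem stmt18 (h Δt : ℝ) (hh : 0 < h) (hΔt : 0 < Δt)
    (ρ ρh u uh p e eh : ℤ → ℝ) (w q Pv Q : ℤ → ℝ)
    (hmass : ∀ i : ℤ, dt Δt ρ ρh i
      + dS h (fun n => avgM ρ n * (avgM u n - w n)) i = 0)
    (hmom : ∀ i : ℤ, dt Δt (fun n => ρ n * u n) (fun n => ρh n * uh n) i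
      + dS h (fun n => (avgM ρ n * (avgM u n - w n)) * avgM u n + avgM p n) i
      = dS h Pv i)
    (hen : ∀ i : ℤ, dt Δt (fun n => (1 / 2) * ρ n * u n ^ 2 + e n)
        (fun n => (1 / 2) * ρh n * uh n ^ 2 + eh n) i
      + dS h (fun n =>
          ((1 / 2) * avgM ρ n * (u n * u (n + 1)) + avgM e n + avgM p n)
            * (avgM u n - w n)
          - (1 / 4) * h ^ 2 * dM h p n * dM h u n) i
      = dS h (fun n => -q n + Pv n * avgM u n) i + avgS Q i) :
    ∀ i : ℤ,
      dt Δt e eh i + (Δt / 2) * ρh i * (dt Δt u uh i) ^ 2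
        + dS h (fun n => avgM e n * (avgM u n - w n)) i
      = -(dS h q i) + avgS (fun n => Pv n * dM h u n) i
        - p i * dS h (fun n => avgM u n - w n) i
        + avgS (fun n => w n * dM h p n) i + avgS Q i := by
  intro i
  have hh' : h ≠ 0 := hh.ne'
  have hΔt' : Δt ≠ 0 := hΔt.ne'
  have hmass_i := hmass i
  have hmom_i := hmom i
  have hen_i := hen i
  simp only [dt, dS, avgM, avgS, dM, sub_add_cancel] at hmass_i hmom_i hen_i ⊢
  linear_combination (norm := skip) hen_i - u i * hmom_i + u i ^ 2 / 2 * hmass_i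
  field_simp
  ring
end

section
/- Let ρ₁, ρ₂, u : ℝ × ℝ → ℝ be differentiable functions of (x, t) satisfying the 1D mass balance equations ∂_tρ_k + ∂_x(ρ_k u) = 0 for k = 1, 2, and let a₁, a₂, c₁, c₂ be real constants. Then at every point (x, t) where c₁ρ₁ + c₂ρ₂ ≠ 0, the function F := (a₁ρ₁ + a₂ρ₂)/(c₁ρ₁ + c₂ρ₂) satisfies ∂_tF + u·∂_xF = 0, i.e., the material derivative of F vanishes. -/
/-- Quotient rule for a ratio of two fixed linear combinations of `f` and `g`. -/
theorem HasDerivAt.linearCombination_div {f g : ℝ → ℝ} {f' g' s : ℝ}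
    (hf : HasDerivAt f f' s) (hg : HasDerivAt g g' s) (a1 a2 c1 c2 : ℝ)
    (h : c1 * f s + c2 * g s ≠ 0) :
    HasDerivAt (fun r => (a1 * f r + a2 * g r) / (c1 * f r + c2 * g r))
      (((a1 * f' + a2 * g') * (c1 * f s + c2 * g s)
        - (a1 * f s + a2 * g s) * (c1 * f' + c2 * g')) / (c1 * f s + c2 * g s) ^ 2) s :=
  ((hf.const_mul a1).add (hg.const_mul a2)).fun_div ((hf.const_mul c1).add (hg.const_mul c2)) h


/-- if `ρ₁, ρ₂, u` are differentiable and satisfy the 1D mass balance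
equations `∂_tρ_k + ∂_x(ρ_k u) = 0`, then the material derivative of
`F = (a₁ρ₁ + a₂ρ₂)/(c₁ρ₁ + c₂ρ₂)` vanishes wherever `c₁ρ₁ + c₂ρ₂ ≠ 0`. -/
theorem stmt19 (ρ1 ρ2 u : ℝ × ℝ → ℝ)
    (hρ1 : Differentiable ℝ ρ1) (hρ2 : Differentiable ℝ ρ2) (hu : Differentiable ℝ u)
    (hmass1 : ∀ z : ℝ × ℝ, deriv (fun t => ρ1 (z.1, t)) z.2
      + deriv (fun x => ρ1 (x, z.2) * u (x, z.2)) z.1 = 0)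
    (hmass2 : ∀ z : ℝ × ℝ, deriv (fun t => ρ2 (z.1, t)) z.2
      + deriv (fun x => ρ2 (x, z.2) * u (x, z.2)) z.1 = 0)
    (a1 a2 c1 c2 : ℝ) :
    ∀ z : ℝ × ℝ, c1 * ρ1 z + c2 * ρ2 z ≠ 0 →
      deriv (fun t => (a1 * ρ1 (z.1, t) + a2 * ρ2 (z.1, t))
          / (c1 * ρ1 (z.1, t) + c2 * ρ2 (z.1, t))) z.2
        + u z * deriv (fun x => (a1 * ρ1 (x, z.2) + a2 * ρ2 (x, z.2))
          / (c1 * ρ1 (x, z.2) + c2 * ρ2 (x, z.2))) z.1 = 0 := by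
  rintro ⟨x, t⟩ hz
  have time_slice {f : ℝ × ℝ → ℝ} (hf : Differentiable ℝ f) :
      HasDerivAt (fun r => f (x, r)) (deriv (fun r => f (x, r)) t) t :=
    DifferentiableAt.hasDerivAt (by fun_prop)
  have space_slice {f : ℝ × ℝ → ℝ} (hf : Differentiable ℝ f) :
      HasDerivAt (fun r => f (r, t)) (deriv (fun r => f (r, t)) x) x :=
    DifferentiableAt.hasDerivAt (by fun_prop)
  have h1 := hmass1 (x, t)
  have h2 := hmass2 (x, t)
  simp only [((space_slice hρ1).fun_mul (space_slice hu)).deriv] at h1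
  simp only [((space_slice hρ2).fun_mul (space_slice hu)).deriv] at h2
  simp only [((time_slice hρ1).linearCombination_div (time_slice hρ2) a1 a2 c1 c2 hz).deriv,
    ((space_slice hρ1).linearCombination_div (space_slice hρ2) a1 a2 c1 c2 hz).deriv]
  rw [eq_neg_of_add_eq_zero_left h1, eq_neg_of_add_eq_zero_left h2]
  field_simp
  ring
end
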